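/- (Lagrangian subproblem equivalence) Fix n ≥ 1, v̂ ∈ ℝ_{>0}^n, ε ∈ ℝ_{≥0}^n, r ∈ ℝ_{≥0}^n, a ∈ ℝ_{≥0}^{n×K}, and μ ∈ ℝ_{≥0}^K. Define the polytope 𝒫 = { (x_0, x, y) ∈ ℝ × ℝ_{≥0}^{n} × ℝ_{≥0}^{n×n} : x_0 + ∑_{i=1}^n v̂_i x_i = 1, x_i ≤ x_0 ∀i, y_{ij} ≤ min{x_i, x_j} ∀i,j }, the set function f(S) = ∑_{i∈S} [ r_i ( v̂_i/(1+∑_{j∈S} v̂_j) + ε_i ) − (∑_{k} a_{ik} μ_k)( v̂_i/(1+∑_{j∈S} v̂_j) − ε_i ) ] for S ⊆ {1,…,n}, and the linear objective L(x_0,x,y) = ∑_{i=1}^n r_i [ (v̂_i + ε_i) x_i + ε_i ∑_{j} v̂_j y_{ij} ] − ∑_{i=1}^n (∑_k a_{ik} μ_k) [ (v̂_i − ε_i) x_i − ε_i ∑_{j} v̂_j y_{ij} ]. Then max_{S ⊆ {1,…,n}} f(S) = max_{(x_0,x,y) ∈ 𝒫} L(x_0,x,y). -/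

import Mathlib

/-- The compact polytope `𝒫`. -/
def compactPolytope (n : ℕ) (vh : Fin n → ℝ) :
    Set (ℝ × (Fin n → ℝ) × (Fin n → Fin n → ℝ)) :=
  {p | (∀ i, 0 ≤ p.2.1 i) ∧ (∀ i j, 0 ≤ p.2.2 i j) ∧
    (p.1 + ∑ i, vh i * p.2.1 i = 1) ∧ (∀ i, p.2.1 i ≤ p.1) ∧
    ∀ i j, p.2.2 i j ≤ min (p.2.1 i) (p.2.1 j)}

/-- The set function `f(S)` of the Lagrangian subproblem. -/
noncomputable def lagrangianSetFn {n K : ℕ} (vh ε r : Fin n → ℝ)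
    (a : Fin n → Fin K → ℝ) (μ : Fin K → ℝ) (S : Finset (Fin n)) : ℝ :=
  ∑ i ∈ S, (r i * (vh i / (1 + ∑ j ∈ S, vh j) + ε i) -
    (∑ k, a i k * μ k) * (vh i / (1 + ∑ j ∈ S, vh j) - ε i))

/-- The linear objective `L(x₀, x, y)` of the Lagrangian subproblem. -/
noncomputable def lagrangianLinObj {n K : ℕ} (vh ε r : Fin n → ℝ)
    (a : Fin n → Fin K → ℝ) (μ : Fin K → ℝ)
    (p : ℝ × (Fin n → ℝ) × (Fin n → Fin n → ℝ)) : ℝ :=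
  ∑ i, r i * ((vh i + ε i) * p.2.1 i + ε i * ∑ j, vh j * p.2.2 i j) -
    ∑ i, (∑ k, a i k * μ k) * ((vh i - ε i) * p.2.1 i - ε i * ∑ j, vh j * p.2.2 i j)

theorem layer_aux {n : ℕ} (e : Fin n → ℝ) (w : Fin n → Fin n → ℝ) (M : ℝ)
    (hF : ∀ S : Finset (Fin n), ∑ i ∈ S, (e i + ∑ j ∈ S, w i j) ≤ M) :
    ∀ (T : Finset (Fin n)) (x : Fin n → ℝ) (t : ℝ), (∀ i, i ∉ T → x i = 0) →
      (∀ i, 0 ≤ x i) → (∀ i, x i ≤ t) → 0 ≤ t →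
      ∑ i, (e i * x i + ∑ j, w i j * min (x i) (x j)) ≤ M * t := by
  intro T
  induction T using Finset.strongInduction with
  | H T ih =>
    intro x t hx0 hx hxt ht
    have hM : 0 ≤ M := by simpa using hF ∅
    rcases T.eq_empty_or_nonempty with rfl | hT
    · have : ∀ i, x i = 0 := fun i => hx0 i (by simp)
      simp [this]
      positivity
    · obtain ⟨i0, hi0, hmin⟩ := T.exists_min_image x hT
      set m := x i0 with hm
      have hm0 : 0 ≤ m := hx i0
      have hmt : m ≤ t := hxt i0
      have key := ih (T.erase i0) (Finset.erase_ssubset hi0)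
        (fun i => if i ∈ T then x i - m else 0) (t - m) ?_ ?_ ?_ (by linarith)
      · have h1 : ∑ i, (e i * x i + ∑ j, w i j * min (x i) (x j)) =
            ∑ i, (e i * (if i ∈ T then x i - m else 0) + ∑ j, w i j *
              min (if i ∈ T then x i - m else 0) (if j ∈ T then x j - m else 0)) +
            m * ∑ i ∈ T, (e i + ∑ j ∈ T, w i j) := by
          have h2 : ∑ i ∈ T, (e i + ∑ j ∈ T, w i j) =
              ∑ i, (if i ∈ T then (e i + ∑ j, if j ∈ T then w i j else 0) else 0) := by
            simp [Finset.sum_ite_mem]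
          rw [h2, Finset.mul_sum, ← Finset.sum_add_distrib]
          refine Finset.sum_congr rfl fun i _ => ?_
          by_cases hi : i ∈ T
          · simp only [hi, if_true]
            rw [mul_add, Finset.mul_sum]
            have : ∑ j, w i j * min (x i) (x j) =
                ∑ j, w i j * min (x i - m) (if j ∈ T then x j - m else 0) +
                ∑ j, m * (if j ∈ T then w i j else 0) := by
              rw [← Finset.sum_add_distrib]
              refine Finset.sum_congr rfl fun j _ => ?_
              by_cases hj : j ∈ T
              · simp only [hj, if_true, min_sub_sub_right]
                ring
              · have := hmin i hi
                simp only [hj, if_false, hx0 j hj, min_eq_right (hx i),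
                  min_eq_right (sub_nonneg.2 this)]
                ring
            rw [this]; ring
          · simp only [hi, if_false, hx0 i hi, min_eq_left (hx _)]
            simp only [mul_zero, add_zero, zero_add]
            refine Finset.sum_congr rfl fun j _ => ?_
            have h0 : (0 : ℝ) ≤ if j ∈ T then x j - m else 0 := by
              split_ifs with hj
              · have := hmin j hj
                linarith
              · exact le_rfl
            rw [min_eq_left h0]
            try simp [hx j]
        rw [h1]
        have := mul_le_mul_of_nonneg_left (hF T) hm0
        linarith
      · intro i hi
        by_cases hiT : i ∈ T
        · have : i = i0 := by
            by_contra hne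
            exact hi (Finset.mem_erase.2 ⟨hne, hiT⟩)
          subst this
          simp [hm]
        · simp [hiT]
      · intro i
        split_ifs with h
        · have := hmin i h
          linarith
        · exact le_rfl
      · intro i
        split_ifs with h
        · have := hxt i
          linarith
        · linarith

/-- Lagrangian subproblem equivalence:
`max_{S ⊆ {1,…,n}} f(S) = max_{(x₀,x,y) ∈ 𝒫} L(x₀,x,y)`. -/
theorem lagrangian_subproblem_equiv (n K : ℕ) (hn : 1 ≤ n)
    (vh ε r : Fin n → ℝ) (a : Fin n → Fin K → ℝ) (μ : Fin K → ℝ)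
    (hv : ∀ i, 0 < vh i) (hε : ∀ i, 0 ≤ ε i) (hr : ∀ i, 0 ≤ r i)
    (ha : ∀ i k, 0 ≤ a i k) (hμ : ∀ k, 0 ≤ μ k) :
    sSup {z : ℝ | ∃ S : Finset (Fin n), z = lagrangianSetFn vh ε r a μ S} =
    sSup {z : ℝ | ∃ p ∈ compactPolytope n vh, z = lagrangianLinObj vh ε r a μ p} := by
  have hc : ∀ i, 0 ≤ ∑ k, a i k * μ k := fun i =>
    Finset.sum_nonneg fun k _ => mul_nonneg (ha i k) (hμ k)
  have hV : ∀ S : Finset (Fin n), 0 < 1 + ∑ j ∈ S, vh j := fun S => by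
    have := Finset.sum_nonneg (s := S) fun j _ => (hv j).le
    linarith
  have hfin : {z : ℝ | ∃ S : Finset (Fin n), z = lagrangianSetFn vh ε r a μ S}.Finite := by
    refine (Set.finite_range (lagrangianSetFn vh ε r a μ)).subset ?_
    rintro z ⟨S, rfl⟩
    exact ⟨S, rfl⟩
  have hub : ∀ p ∈ compactPolytope n vh, lagrangianLinObj vh ε r a μ p ≤
      sSup {z : ℝ | ∃ S : Finset (Fin n), z = lagrangianSetFn vh ε r a μ S} := by
    rintro ⟨x0, x, y⟩ ⟨hx, hy, hsum, hxx, hyx⟩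
    dsimp only at hx hy hsum hxx hyx
    set M := sSup {z : ℝ | ∃ S : Finset (Fin n), z = lagrangianSetFn vh ε r a μ S} with hMdef
    have hf : ∀ S, lagrangianSetFn vh ε r a μ S ≤ M := fun S =>
      le_csSup hfin.bddAbove ⟨S, rfl⟩
    have hx0 : 0 ≤ x0 := (hx ⟨0, hn⟩).trans (hxx _)
    have key := layer_aux
      (fun i => r i * (vh i + ε i) - (∑ k, a i k * μ k) * (vh i - ε i) - M * vh i)
      (fun i j => (r i + ∑ k, a i k * μ k) * ε i * vh j) M ?_ Finset.univ x x0
      (by simp) hx hxx hx0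
    · have h1 : lagrangianLinObj vh ε r a μ (x0, x, y) ≤
          ∑ i, ((r i * (vh i + ε i) - (∑ k, a i k * μ k) * (vh i - ε i) - M * vh i) * x i
            + ∑ j, (r i + ∑ k, a i k * μ k) * ε i * vh j * min (x i) (x j))
          + M * ∑ i, vh i * x i := by
        unfold lagrangianLinObj
        rw [← Finset.sum_sub_distrib, Finset.mul_sum, ← Finset.sum_add_distrib]
        refine Finset.sum_le_sum fun i _ => ?_
        have h2 : (r i + ∑ k, a i k * μ k) * ε i * ∑ j, vh j * y i j ≤
            ∑ j, (r i + ∑ k, a i k * μ k) * ε i * vh j * min (x i) (x j) := by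
          rw [Finset.mul_sum]
          refine Finset.sum_le_sum fun j _ => ?_
          rw [← mul_assoc]
          exact mul_le_mul_of_nonneg_left (hyx i j)
            (mul_nonneg (mul_nonneg (add_nonneg (hr i) (hc i)) (hε i)) (hv j).le)
        dsimp only
        linarith
      have h3 : M * (x0 + ∑ i, vh i * x i) = M := by rw [hsum, mul_one]
      linarith
    · intro S
      have h4 := mul_le_mul_of_nonneg_right (hf S) (hV S).le
      have h5 : lagrangianSetFn vh ε r a μ S * (1 + ∑ j ∈ S, vh j) =
          ∑ i ∈ S, (r i * (vh i + ε i) - (∑ k, a i k * μ k) * (vh i - ε i) - M * vh i +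
            ∑ j ∈ S, (r i + ∑ k, a i k * μ k) * ε i * vh j) + M * ∑ j ∈ S, vh j := by
        unfold lagrangianSetFn
        rw [Finset.sum_mul, Finset.mul_sum, ← Finset.sum_add_distrib]
        refine Finset.sum_congr rfl fun i _ => ?_
        rw [← Finset.mul_sum]
        have := (hV S).ne'
        field_simp
        ring
      linarith
  have hatt : ∀ S : Finset (Fin n), ∃ p ∈ compactPolytope n vh,
      lagrangianSetFn vh ε r a μ S = lagrangianLinObj vh ε r a μ p := by
    intro S
    have hpos : 0 ≤ (1 + ∑ j ∈ S, vh j)⁻¹ := (inv_pos.2 (hV S)).le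
    refine ⟨((1 + ∑ j ∈ S, vh j)⁻¹, fun i => if i ∈ S then (1 + ∑ j ∈ S, vh j)⁻¹ else 0,
      fun i j => if i ∈ S then if j ∈ S then (1 + ∑ j ∈ S, vh j)⁻¹ else 0 else 0),
      ⟨?_, ?_, ?_, ?_, ?_⟩, ?_⟩
    · intro i; dsimp only; split_ifs <;> simp [hpos]
    · intro i j; dsimp only; split_ifs <;> simp [hpos]
    · have := (hV S).ne'
      simp only [mul_ite, mul_zero, Finset.sum_ite_mem, Finset.univ_inter]
      rw [← Finset.sum_mul]
      field_simp
    · intro i; dsimp only; split_ifs <;> simp [hpos]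
    · intro i j; dsimp only; split_ifs <;> simp [hpos]
    · unfold lagrangianLinObj lagrangianSetFn
      rw [← Finset.sum_sub_distrib, ← Finset.univ_inter S, ← Finset.sum_ite_mem,
        Finset.univ_inter S]
      refine Finset.sum_congr rfl fun i _ => ?_
      by_cases hi : i ∈ S
      · simp only [hi, if_true, mul_ite, mul_zero, Finset.sum_ite_mem, Finset.univ_inter]
        rw [← Finset.sum_mul]
        have := (hV S).ne'
        field_simp
        ring
      · simp [hi]
  apply le_antisymm
  · refine csSup_le ⟨_, ∅, rfl⟩ ?_
    rintro z ⟨S, rfl⟩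
    obtain ⟨p, hp, h⟩ := hatt S
    refine le_csSup ⟨sSup {z : ℝ | ∃ S : Finset (Fin n), z = lagrangianSetFn vh ε r a μ S}, ?_⟩
      ⟨p, hp, h⟩
    rintro z ⟨q, hq, rfl⟩
    exact hub q hq
  · obtain ⟨p, hp, h⟩ := hatt ∅
    refine csSup_le ⟨_, p, hp, rfl⟩ ?_
    rintro z ⟨q, hq, rfl⟩
    exact hub q hq
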